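/- arXiv:2005.09279 — 7 statements merged into one kernel-verified Lean document; each statement's English description precedes it below -/
import Mathlib

section
/- Let T > 0 and c₁, c₂ > 0, and let f : [0, T] → [0, ∞) be differentiable with f'(t) + c₁ f(t)² ≤ c₂ for every t ∈ [0, T]. Then for every t ∈ (0, T], f(t) ≤ max( 2/(c₁ t), (2c₂/c₁)^{1/2} ). -/
/-- Comparison lemma: if `f' + c₁ f² ≤ c₂` on `[0,T]` with `f ≥ 0`, then for `t ∈ (0,T]`,
`f(t) ≤ max (2/(c₁ t)) ((2c₂/c₁)^{1/2})`, independently of `f(0)`. -/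
theorem stmt_2 (T c₁ c₂ : ℝ) (hT : 0 < T) (hc₁ : 0 < c₁) (hc₂ : 0 < c₂)
    (f f' : ℝ → ℝ)
    (hnonneg : ∀ t ∈ Set.Icc (0 : ℝ) T, 0 ≤ f t)
    (hderiv : ∀ t ∈ Set.Icc (0 : ℝ) T, HasDerivWithinAt f (f' t) (Set.Icc (0 : ℝ) T) t)
    (hineq : ∀ t ∈ Set.Icc (0 : ℝ) T, f' t + c₁ * (f t) ^ 2 ≤ c₂) :
    ∀ t ∈ Set.Ioc (0 : ℝ) T, f t ≤ max (2 / (c₁ * t)) (Real.sqrt (2 * c₂ / c₁)) := by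
  intro t ht
  by_contra! hlt
  obtain ⟨h_inv, h_sqrt⟩ := max_lt_iff.mp hlt
  have hright : ∀ x ∈ Set.Ico 0 t, HasDerivWithinAt f (f' x) (Set.Ici x) x := fun x hx ↦
    (hderiv x ⟨hx.1, hx.2.le.trans ht.2⟩).mono_of_mem_nhdsWithin
      (Icc_mem_nhdsGE_of_mem ⟨hx.1, hx.2.trans_le ht.2⟩)
  have hcont : ContinuousOn f (Set.Icc 0 t) := fun x hx ↦
    (hderiv x ⟨hx.1, hx.2.trans ht.2⟩).continuousWithinAt.mono (Set.Icc_subset_Icc_right ht.2)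
  have hsq : Real.sqrt (2 * c₂ / c₁) ^ 2 = 2 * c₂ / c₁ := Real.sq_sqrt (by positivity)
  have hpos : 0 < Real.sqrt (2 * c₂ / c₁) := Real.sqrt_pos.mpr (by positivity)
  -- the level `√(2c₂/c₁)` cannot be crossed upwards
  have hlarge : ∀ s ∈ Set.Icc 0 t, Real.sqrt (2 * c₂ / c₁) < f s := by
    intro s hs
    by_contra! hle
    refine h_sqrt.not_ge (image_le_of_deriv_right_lt_deriv_boundary' (a := s) (b := t)
      (hcont.mono (Set.Icc_subset_Icc_left hs.1)) (fun x hx ↦ hright x ⟨hs.1.trans hx.1, hx.2⟩)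
      hle continuousOn_const (fun x _ ↦ hasDerivWithinAt_const x _ _) ?_ ⟨hs.2, le_rfl⟩)
    intro x hx hfx
    have h := hineq x ⟨hs.1.trans hx.1, hx.2.le.trans ht.2⟩
    rw [hfx, hsq, mul_div_cancel₀ _ hc₁.ne'] at h
    linarith
  have hfpos : ∀ s ∈ Set.Icc 0 t, 0 < f s := fun s hs ↦ hpos.trans (hlarge s hs)
  -- above that level, `1 / f` grows at rate at least `c₁ / 2`
  have hgrow : -(f t)⁻¹ ≤ -(f 0)⁻¹ - c₁ / 2 * t := by
    refine image_le_of_deriv_right_le_deriv_boundary (f := fun s ↦ -(f s)⁻¹)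
      (f' := fun s ↦ -(-f' s / f s ^ 2)) (B := fun s ↦ -(f 0)⁻¹ - c₁ / 2 * s)
      (B' := fun _ ↦ -(c₁ / 2)) (a := 0) (b := t)
      (hcont.inv₀ fun s hs ↦ (hfpos s hs).ne').neg
      (fun x hx ↦ ((hright x hx).inv (hfpos x ⟨hx.1, hx.2.le⟩).ne').neg)
      (by simp) (by fun_prop) ?_ ?_ ⟨ht.1.le, le_rfl⟩
    · intro x _
      simpa using (((hasDerivAt_id x).const_mul (c₁ / 2)).const_sub (-(f 0)⁻¹)).hasDerivWithinAt
    · intro x hx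
      have hx' : x ∈ Set.Icc 0 t := ⟨hx.1, hx.2.le⟩
      have h := hineq x ⟨hx.1, hx.2.le.trans ht.2⟩
      have hlt_sq : 2 * c₂ / c₁ < f x ^ 2 := hsq ▸ pow_lt_pow_left₀ (hlarge x hx') hpos.le two_ne_zero
      rw [div_lt_iff₀ hc₁] at hlt_sq
      rw [neg_div, neg_neg, div_le_iff₀ (pow_pos (hfpos x hx') 2)]
      linarith
  have h0 : 0 < (f 0)⁻¹ := inv_pos.mpr (hfpos 0 ⟨le_rfl, ht.1.le⟩)
  have hft : (f t)⁻¹ < c₁ * t / 2 := by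
    rw [← inv_div]
    exact inv_strictAnti₀ (div_pos two_pos (mul_pos hc₁ ht.1)) h_inv
  linarith
end

section
/- Let d ≥ 1 be an integer and let l, r ∈ (0, d) with l + r > d. Then there exists a constant C > 0, depending only on d, l and r, such that for every k ∈ ℤ^d the series ∑_{k₁ ∈ ℤ^d} (1 + |k₁|)^{−l} (1 + |k − k₁|)^{−r} converges and ∑_{k₁ ∈ ℤ^d} (1 + |k₁|)^{−l} (1 + |k − k₁|)^{−r} ≤ C (1 + |k|)^{d − l − r}. -/
open scoped BigOperators

/-- Euclidean norm of a lattice point of `ℤ^d`. -/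
noncomputable def latticeNorm {d : ℕ} (k : Fin d → ℤ) : ℝ :=
  Real.sqrt (∑ i, ((k i : ℝ)) ^ 2)

open scoped ENNReal

lemma latticeNorm_eq_norm {d : ℕ} (k : Fin d → ℤ) :
    latticeNorm k = ‖WithLp.toLp 2 (fun i => (k i : ℝ))‖ := by
  simp [latticeNorm, EuclideanSpace.norm_eq]

lemma latticeNorm_nonneg {d : ℕ} (k : Fin d → ℤ) : 0 ≤ latticeNorm k :=
  Real.sqrt_nonneg _

lemma latticeNorm_add_le {d : ℕ} (x y : Fin d → ℤ) :
    latticeNorm (x + y) ≤ latticeNorm x + latticeNorm y := by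
  simp only [latticeNorm_eq_norm]
  refine le_trans (le_of_eq ?_) (norm_add_le _ _)
  congr 1
  ext i
  simp

lemma abs_le_latticeNorm {d : ℕ} (k : Fin d → ℤ) (i : Fin d) : |(k i : ℝ)| ≤ latticeNorm k := by
  rw [latticeNorm, ← Real.sqrt_sq_eq_abs]
  exact Real.sqrt_le_sqrt
    (Finset.single_le_sum (f := fun i => (k i : ℝ) ^ 2) (fun _ _ => sq_nonneg _)
      (Finset.mem_univ i))

/-- The number of lattice points with `1 + |x| ≤ ρ` is at most `(3ρ)^d`. -/
lemma tsum_indicator_latticeNorm_le (d : ℕ) {ρ : ℝ} (hρ : 0 < ρ) :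
    ∑' x : Fin d → ℤ, {x : Fin d → ℤ | 1 + latticeNorm x ≤ ρ}.indicator (fun _ => (1 : ℝ≥0∞)) x
      ≤ ENNReal.ofReal ((3 * ρ) ^ d) := by
  rcases lt_or_ge ρ 1 with h | h
  · have h0 : ∀ x : Fin d → ℤ,
        {x : Fin d → ℤ | 1 + latticeNorm x ≤ ρ}.indicator (fun _ => (1 : ℝ≥0∞)) x = 0 := by
      intro x
      refine Set.indicator_of_notMem ?_ _
      have := latticeNorm_nonneg x
      simp only [Set.mem_ofPred_eq, not_le]
      linarith
    simp [h0]
  · set F : Finset (Fin d → ℤ) := Fintype.piFinset fun _ => Finset.Icc (-⌊ρ⌋) ⌊ρ⌋ with hF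
    have hsub : ∀ x ∉ F,
        {x : Fin d → ℤ | 1 + latticeNorm x ≤ ρ}.indicator (fun _ => (1 : ℝ≥0∞)) x = 0 := by
      intro x hx
      refine Set.indicator_of_notMem (fun hxρ => hx ?_) _
      rw [hF, Fintype.mem_piFinset]
      intro i
      have hi := abs_le.1 ((abs_le_latticeNorm x i).trans
        (show latticeNorm x ≤ ρ by simp only [Set.mem_ofPred_eq] at hxρ; linarith))
      have h1 : x i ≤ ⌊ρ⌋ := Int.le_floor.2 hi.2
      have h2 : -x i ≤ ⌊ρ⌋ := Int.le_floor.2 (by push_cast; linarith [hi.1])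
      exact Finset.mem_Icc.2 ⟨by linarith, h1⟩
    rw [tsum_eq_sum hsub]
    have hfl : (0 : ℤ) ≤ ⌊ρ⌋ := Int.floor_nonneg.2 hρ.le
    have hcard : (F.card : ℝ) ≤ (3 * ρ) ^ d := by
      have hc : F.card = (⌊ρ⌋ + 1 - -⌊ρ⌋).toNat ^ d := by simp [hF]
      rw [hc]
      push_cast
      refine pow_le_pow_left₀ (by positivity) ?_ d
      have h1 : (((⌊ρ⌋ + 1 - -⌊ρ⌋).toNat : ℤ) : ℝ) = ((⌊ρ⌋ + 1 - -⌊ρ⌋ : ℤ) : ℝ) := by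
        rw [Int.toNat_of_nonneg (by linarith)]
      rw [Int.cast_natCast] at h1
      rw [h1]
      push_cast
      linarith [Int.floor_le ρ]
    calc ∑ x ∈ F, {x : Fin d → ℤ | 1 + latticeNorm x ≤ ρ}.indicator (fun _ => (1 : ℝ≥0∞)) x
        ≤ ∑ x ∈ F, 1 := Finset.sum_le_sum fun x _ => Set.indicator_le_self' (by simp) x
      _ = ENNReal.ofReal (F.card : ℝ) := by simp
      _ ≤ _ := ENNReal.ofReal_le_ofReal hcard

/-- Summation of a negative power of `1 + |x|` over a set covered by geometric shells. -/
lemma tsum_indicator_rpow_le_of_shells (d : ℕ) {s t R : ℝ} (hs : 0 ≤ s) (ht : 0 < t) (hR : 0 < R)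
    (hts : t ^ ((d : ℝ) - s) < 1) (S : Set (Fin d → ℤ))
    (hS : ∀ x ∈ S, ∃ n : ℕ, t ^ n * R / 2 ≤ 1 + latticeNorm x ∧
      1 + latticeNorm x ≤ 2 * (t ^ n * R)) :
    ∑' x, S.indicator (fun x => ENNReal.ofReal ((1 + latticeNorm x) ^ (-s))) x
      ≤ ENNReal.ofReal (6 ^ d * 2 ^ s * (1 - t ^ ((d : ℝ) - s))⁻¹ * R ^ ((d : ℝ) - s)) := by
  have hq : 0 ≤ t ^ ((d : ℝ) - s) := by positivity
  have hpt : ∀ x, S.indicator (fun x => ENNReal.ofReal ((1 + latticeNorm x) ^ (-s))) x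
      ≤ ∑' n : ℕ, ENNReal.ofReal ((t ^ n * R / 2) ^ (-s)) *
        {x : Fin d → ℤ | 1 + latticeNorm x ≤ 2 * (t ^ n * R)}.indicator
          (fun _ => (1 : ℝ≥0∞)) x := by
    intro x
    by_cases hx : x ∈ S
    · obtain ⟨n, h1, h2⟩ := hS x hx
      refine le_trans ?_ (ENNReal.le_tsum n)
      rw [Set.indicator_of_mem hx, Set.indicator_of_mem (by exact h2), mul_one]
      exact ENNReal.ofReal_le_ofReal
        (Real.rpow_le_rpow_of_nonpos (by positivity) h1 (by linarith))
    · rw [Set.indicator_of_notMem hx]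
      exact zero_le
  refine (ENNReal.tsum_le_tsum hpt).trans ?_
  rw [ENNReal.tsum_comm]
  have hn : ∀ n : ℕ, ∑' x : Fin d → ℤ, ENNReal.ofReal ((t ^ n * R / 2) ^ (-s)) *
        {x : Fin d → ℤ | 1 + latticeNorm x ≤ 2 * (t ^ n * R)}.indicator
          (fun _ => (1 : ℝ≥0∞)) x
      ≤ ENNReal.ofReal (6 ^ d * 2 ^ s * R ^ ((d : ℝ) - s) * (t ^ ((d : ℝ) - s)) ^ n) := by
    intro n
    have hpos : 0 < t ^ n * R := by positivity
    rw [ENNReal.tsum_mul_left]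
    refine (mul_le_mul_right (tsum_indicator_latticeNorm_le d
      (show 0 < 2 * (t ^ n * R) by positivity)) _).trans ?_
    rw [← ENNReal.ofReal_mul (by positivity)]
    refine ENNReal.ofReal_le_ofReal (le_of_eq ?_)
    have e1 : (t ^ ((d : ℝ) - s)) ^ n = (t ^ n) ^ ((d : ℝ) - s) := by
      rw [← Real.rpow_natCast, ← Real.rpow_natCast, ← Real.rpow_mul ht.le, ← Real.rpow_mul ht.le,
        mul_comm]
    rw [e1, mul_assoc (6 ^ d * 2 ^ s), ← Real.mul_rpow hR.le (by positivity), mul_comm R,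
      Real.div_rpow hpos.le zero_le_two, Real.rpow_sub hpos, Real.rpow_natCast,
      Real.rpow_neg hpos.le, Real.rpow_neg zero_le_two, ← mul_assoc 3 2, mul_pow (3 * 2 : ℝ)]
    norm_num
    field_simp
  refine (ENNReal.tsum_le_tsum hn).trans ?_
  rw [← ENNReal.ofReal_tsum_of_nonneg (fun n => by positivity)
    ((summable_geometric_of_lt_one hq hts).mul_left _), tsum_mul_left,
    tsum_geometric_of_lt_one hq hts]
  exact ENNReal.ofReal_le_ofReal (le_of_eq (by ring))

/-- `∑_{1+|x| ≤ R} (1+|x|)^{-s} ≲ R^{d-s}` for `0 ≤ s < d`. -/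
lemma exists_tsum_ball_rpow_le (d : ℕ) {s : ℝ} (hs : 0 ≤ s) (hsd : s < d) :
    ∃ C : ℝ, 0 < C ∧ ∀ R : ℝ, 0 < R →
      ∑' x : Fin d → ℤ, {x : Fin d → ℤ | 1 + latticeNorm x ≤ R}.indicator
        (fun x => ENNReal.ofReal ((1 + latticeNorm x) ^ (-s))) x
        ≤ ENNReal.ofReal (C * R ^ ((d : ℝ) - s)) := by
  have hq : (1 / 2 : ℝ) ^ ((d : ℝ) - s) < 1 :=
    Real.rpow_lt_one (by norm_num) (by norm_num) (by linarith)
  have hq' := sub_pos.2 hq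
  refine ⟨_, ?_, fun R hR => tsum_indicator_rpow_le_of_shells d hs (by norm_num) hR hq _ ?_⟩
  · positivity
  · intro x hx
    have hx0 : 0 < 1 + latticeNorm x := by linarith [latticeNorm_nonneg x]
    obtain ⟨n, h1, h2⟩ := exists_nat_pow_near ((one_le_div hx0).2 hx) (one_lt_two (α := ℝ))
    rw [le_div_iff₀ hx0] at h1
    rw [div_lt_iff₀ hx0, pow_succ] at h2
    have h2n : (0 : ℝ) < 2 ^ n := by positivity
    have e : (1 / 2 : ℝ) ^ n * R = R / 2 ^ n := by rw [one_div, inv_pow]; field_simp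
    refine ⟨n, ?_, ?_⟩
    · rw [e, div_div, div_le_iff₀ (by positivity)]
      linarith
    · rw [e, mul_div_assoc', le_div_iff₀ h2n]
      linarith

/-- `∑_{1+|x| ≥ R} (1+|x|)^{-s} ≲ R^{d-s}` for `s > d`. -/
lemma exists_tsum_ball_compl_rpow_le (d : ℕ) {s : ℝ} (hsd : d < s) :
    ∃ C : ℝ, 0 < C ∧ ∀ R : ℝ, 0 < R →
      ∑' x : Fin d → ℤ, {x : Fin d → ℤ | R ≤ 1 + latticeNorm x}.indicator
        (fun x => ENNReal.ofReal ((1 + latticeNorm x) ^ (-s))) x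
        ≤ ENNReal.ofReal (C * R ^ ((d : ℝ) - s)) := by
  have hs : 0 ≤ s := (Nat.cast_nonneg d).trans hsd.le
  have hq : (2 : ℝ) ^ ((d : ℝ) - s) < 1 :=
    Real.rpow_lt_one_of_one_lt_of_neg one_lt_two (by linarith)
  have hq' := sub_pos.2 hq
  refine ⟨_, ?_, fun R hR => tsum_indicator_rpow_le_of_shells d hs zero_lt_two hR hq _ ?_⟩
  · positivity
  · intro x hx
    obtain ⟨n, h1, h2⟩ := exists_nat_pow_near ((one_le_div hR).2 hx) (one_lt_two (α := ℝ))
    rw [le_div_iff₀ hR] at h1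
    rw [div_lt_iff₀ hR, pow_succ] at h2
    have h2n : 0 < (2 : ℝ) ^ n * R := by positivity
    exact ⟨n, by linarith, by linarith⟩

lemma summable_and_tsum_le_of_tsum_ofReal_le {α : Type*} {f : α → ℝ} (hf : ∀ x, 0 ≤ f x) {B : ℝ}
    (hB : 0 ≤ B) (h : ∑' x, ENNReal.ofReal (f x) ≤ ENNReal.ofReal B) :
    Summable f ∧ ∑' x, f x ≤ B := by
  have hsum : ∀ u : Finset α, ∑ x ∈ u, f x ≤ B := by
    intro u
    rw [← ENNReal.ofReal_le_ofReal_iff hB, ENNReal.ofReal_sum_of_nonneg fun x _ => hf x]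
    exact (ENNReal.sum_le_tsum u).trans h
  exact ⟨summable_of_sum_le hf hsum, Real.tsum_le_of_sum_le hf hsum⟩

/-- Splitting of a product of negative powers according to the sizes of the factors. -/
lemma ofReal_rpow_mul_rpow_le {a b R l r : ℝ} (ha : 0 < a) (hb : 0 < b) (hR : 0 < R)
    (hl : 0 ≤ l) (hr : 0 ≤ r) (hab : 2 * R ≤ a + b) :
    ENNReal.ofReal (a ^ (-l) * b ^ (-r)) ≤
      ENNReal.ofReal (R ^ (-r)) * {a | a ≤ R}.indicator (fun a => ENNReal.ofReal (a ^ (-l))) a +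
      ENNReal.ofReal (R ^ (-l)) * {b | b ≤ R}.indicator (fun b => ENNReal.ofReal (b ^ (-r))) b +
      {a | R ≤ a}.indicator (fun a => ENNReal.ofReal (a ^ (-(l + r)))) a +
      {b | R ≤ b}.indicator (fun b => ENNReal.ofReal (b ^ (-(l + r)))) b := by
  rcases le_total a R with h1 | h1
  · refine le_add_right (le_add_right (le_add_right ?_))
    rw [Set.indicator_of_mem (by exact h1), ← ENNReal.ofReal_mul (by positivity), mul_comm]
    refine ENNReal.ofReal_le_ofReal (mul_le_mul_of_nonneg_right ?_ (by positivity))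
    exact Real.rpow_le_rpow_of_nonpos hR (by linarith) (by linarith)
  rcases le_total b R with h2 | h2
  · refine le_add_right (le_add_right (le_add_left ?_))
    rw [Set.indicator_of_mem (by exact h2), ← ENNReal.ofReal_mul (by positivity)]
    refine ENNReal.ofReal_le_ofReal (mul_le_mul_of_nonneg_right ?_ (by positivity))
    exact Real.rpow_le_rpow_of_nonpos hR (by linarith) (by linarith)
  rcases le_total a b with h3 | h3
  · refine le_add_right (le_add_left ?_)
    rw [Set.indicator_of_mem (by exact h1), neg_add, Real.rpow_add ha]
    refine ENNReal.ofReal_le_ofReal (mul_le_mul_of_nonneg_left ?_ (by positivity))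
    exact Real.rpow_le_rpow_of_nonpos ha h3 (by linarith)
  · refine le_add_left ?_
    rw [Set.indicator_of_mem (by exact h2), neg_add, Real.rpow_add hb]
    refine ENNReal.ofReal_le_ofReal (mul_le_mul_of_nonneg_right ?_ (by positivity))
    exact Real.rpow_le_rpow_of_nonpos hb h3 (by linarith)

/-- Discrete convolution estimate: for `0 < l, r < d` with `l + r > d`, one has
`∑_{k₁ ∈ ℤ^d} (1+|k₁|)^{-l} (1+|k-k₁|)^{-r} ≲ (1+|k|)^{d-l-r}`. -/
theorem stmt_3 (d : ℕ) (hd : 1 ≤ d) (l r : ℝ)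
    (hl : 0 < l) (hl' : l < d) (hr : 0 < r) (hr' : r < d) (hlr : d < l + r) :
    ∃ C : ℝ, 0 < C ∧ ∀ k : Fin d → ℤ,
      Summable (fun k₁ : Fin d → ℤ =>
        (1 + latticeNorm k₁) ^ (-l) * (1 + latticeNorm (k - k₁)) ^ (-r)) ∧
      (∑' k₁ : Fin d → ℤ,
        (1 + latticeNorm k₁) ^ (-l) * (1 + latticeNorm (k - k₁)) ^ (-r))
        ≤ C * (1 + latticeNorm k) ^ ((d : ℝ) - l - r) := by
  obtain ⟨A, hA, hA'⟩ := exists_tsum_ball_rpow_le d hl.le hl'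
  obtain ⟨B, hB, hB'⟩ := exists_tsum_ball_rpow_le d hr.le hr'
  obtain ⟨D, hD, hD'⟩ := exists_tsum_ball_compl_rpow_le d hlr
  refine ⟨(A + B + D + D) * (1 / 2) ^ ((d : ℝ) - l - r), by positivity, fun k => ?_⟩
  have hw : ∀ x : Fin d → ℤ, 0 < 1 + latticeNorm x := fun x => by
    linarith [latticeNorm_nonneg x]
  refine summable_and_tsum_le_of_tsum_ofReal_le
    (fun x => mul_nonneg (Real.rpow_nonneg (hw _).le _) (Real.rpow_nonneg (hw _).le _))
    (mul_nonneg (by positivity) (Real.rpow_nonneg (hw _).le _)) ?_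
  obtain ⟨R, hRdef⟩ : ∃ R : ℝ, R = 1 / 2 * (1 + latticeNorm k) := ⟨_, rfl⟩
  have hR : 0 < R := by rw [hRdef]; linarith [hw k]
  rw [mul_assoc, ← Real.mul_rpow (by norm_num) (hw k).le, ← hRdef]
  have hpt := fun x : Fin d → ℤ => ofReal_rpow_mul_rpow_le (hw x) (hw (k - x)) hR hl.le hr.le
    (by
      have := latticeNorm_add_le x (k - x)
      rw [add_sub_cancel] at this
      linarith)
  have hshift : ∀ g : (Fin d → ℤ) → ℝ≥0∞, ∑' x, g (k - x) = ∑' x, g x :=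
    fun g => (Equiv.subLeft k).tsum_eq g
  refine (ENNReal.tsum_le_tsum hpt).trans ?_
  rw [ENNReal.tsum_add, ENNReal.tsum_add, ENNReal.tsum_add, ENNReal.tsum_mul_left,
    ENNReal.tsum_mul_left,
    hshift fun x => {b | b ≤ R}.indicator (fun b => ENNReal.ofReal (b ^ (-r))) (1 + latticeNorm x),
    hshift fun x => {b | R ≤ b}.indicator (fun b => ENNReal.ofReal (b ^ (-(l + r))))
      (1 + latticeNorm x)]
  refine (add_le_add (add_le_add (add_le_add (mul_le_mul_right (hA' R hR) _)
    (mul_le_mul_right (hB' R hR) _)) (hD' R hR)) (hD' R hR)).trans ?_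
  rw [← ENNReal.ofReal_mul (by positivity), ← ENNReal.ofReal_mul (by positivity),
    ← ENNReal.ofReal_add (by positivity) (by positivity),
    ← ENNReal.ofReal_add (by positivity) (by positivity),
    ← ENNReal.ofReal_add (by positivity) (by positivity)]
  refine ENNReal.ofReal_le_ofReal (le_of_eq ?_)
  rw [mul_left_comm _ A, mul_left_comm _ B, ← Real.rpow_add hR, ← Real.rpow_add hR,
    show -r + ((d : ℝ) - l) = d - l - r by ring, show -l + ((d : ℝ) - r) = d - l - r by ring,
    show (d : ℝ) - (l + r) = d - l - r by ring]
  ring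
end

section
/- Let m > 0. For μ ∈ (−m, ∞) the series ∑_{k ∈ ℤ²} ( 1/(‖k‖² + m + μ) − 1/(‖k‖² + m) ) converges absolutely, so F(μ) := (1/2) ∑_{k ∈ ℤ²} ( 1/(‖k‖² + m + μ) − 1/(‖k‖² + m) ) is well defined; moreover μ = 0 is the unique μ ∈ (−m, ∞) satisfying F(μ) = μ. -/
lemma summable_one_div_int_sq_add {d : ℝ} (hd : 0 < d) :
    Summable (fun n : ℤ => 1 / ((n : ℝ) ^ 2 + d)) := by
  refine Summable.of_norm_bounded_eventually
    (Real.summable_one_div_int_pow (p := 2) |>.mpr (by norm_num)) ?_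
  filter_upwards [(Set.finite_singleton (0 : ℤ)).compl_mem_cofinite] with n hn
  have hn0 : (n : ℝ) ≠ 0 := by exact_mod_cast hn
  have hsq : 0 < (n : ℝ) ^ 2 := by positivity
  rw [Real.norm_of_nonneg (by positivity)]
  exact one_div_le_one_div_of_le hsq (by linarith)

lemma abs_one_div_add_sub_one_div_le {m μ c x y : ℝ} (hc : 0 < c) (hcm : 2 * c ≤ m)
    (hcμ : 2 * c ≤ m + μ) (hx : 0 ≤ x) (hy : 0 ≤ y) :
    |1 / (x + y + m + μ) - 1 / (x + y + m)| ≤ |μ| * (1 / (x + c) * (1 / (y + c))) := by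
  have h1 : 0 < x + y + m + μ := by linarith
  have h2 : 0 < x + y + m := by linarith
  have h : 1 / (x + y + m + μ) - 1 / (x + y + m) = -μ / ((x + y + m + μ) * (x + y + m)) := by
    field_simp
    ring
  rw [h, abs_div, abs_neg, abs_of_pos (mul_pos h1 h2), one_div_mul_one_div, ← div_eq_mul_one_div]
  apply div_le_div_of_nonneg_left (abs_nonneg μ) (by positivity)
  exact mul_le_mul (by linarith) (by linarith) (by positivity) h1.le

/-- For `m > 0` and `μ > -m`, the series
`∑_{k ∈ ℤ²} (1/(‖k‖²+m+μ) − 1/(‖k‖²+m))` converges absolutely, and `μ = 0` is the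
unique `μ ∈ (−m, ∞)` solving the self-consistent equation
`(1/2) ∑_{k ∈ ℤ²} (1/(‖k‖²+m+μ) − 1/(‖k‖²+m)) = μ`. -/
theorem stmt_4 (m : ℝ) (hm : 0 < m) :
    (∀ μ : ℝ, -m < μ →
      Summable (fun k : ℤ × ℤ =>
        |1 / ((k.1 : ℝ) ^ 2 + (k.2 : ℝ) ^ 2 + m + μ)
          - 1 / ((k.1 : ℝ) ^ 2 + (k.2 : ℝ) ^ 2 + m)|)) ∧
    (∀ μ : ℝ, -m < μ →
      ((1 / 2) * ∑' k : ℤ × ℤ,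
          (1 / ((k.1 : ℝ) ^ 2 + (k.2 : ℝ) ^ 2 + m + μ)
            - 1 / ((k.1 : ℝ) ^ 2 + (k.2 : ℝ) ^ 2 + m)) = μ
        ↔ μ = 0)) := by
  constructor
  · intro μ hμ
    obtain ⟨c, hc, hcm, hcμ⟩ : ∃ c : ℝ, 0 < c ∧ 2 * c ≤ m ∧ 2 * c ≤ m + μ := by
      refine ⟨min m (m + μ) / 2, half_pos (lt_min hm (by linarith)), ?_, ?_⟩
      · linarith [min_le_left m (m + μ)]
      · linarith [min_le_right m (m + μ)]
    have hs := summable_one_div_int_sq_add hc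
    have hnonneg : 0 ≤ fun n : ℤ => 1 / ((n : ℝ) ^ 2 + c) := fun n => by
      simp only [Pi.zero_apply]
      positivity
    exact ((hs.mul_of_nonneg hs hnonneg hnonneg).mul_left |μ|).of_nonneg_of_le
      (fun _ => abs_nonneg _)
      fun k => abs_one_div_add_sub_one_div_le hc hcm hcμ (sq_nonneg _) (sq_nonneg _)
  · intro μ hμ
    refine ⟨fun h => le_antisymm ?_ ?_, fun h => by simp [h]⟩
    · by_contra! hpos
      have hsum : ∑' k : ℤ × ℤ, (1 / ((k.1 : ℝ) ^ 2 + (k.2 : ℝ) ^ 2 + m + μ)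
          - 1 / ((k.1 : ℝ) ^ 2 + (k.2 : ℝ) ^ 2 + m)) ≤ 0 :=
        tsum_nonpos fun k => sub_nonpos.mpr
          (one_div_le_one_div_of_le (by positivity) (by linarith))
      linarith
    · by_contra! hneg
      have hsum : 0 ≤ ∑' k : ℤ × ℤ, (1 / ((k.1 : ℝ) ^ 2 + (k.2 : ℝ) ^ 2 + m + μ)
          - 1 / ((k.1 : ℝ) ^ 2 + (k.2 : ℝ) ^ 2 + m)) :=
        tsum_nonneg fun k => sub_nonneg.mpr
          (one_div_le_one_div_of_le (by nlinarith [sq_nonneg (k.1 : ℝ), sq_nonneg (k.2 : ℝ)])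
            (by linarith))
      linarith
end

section
/- Let m ≥ 0 and a > 0. For μ ∈ (−m, ∞) the series ∑_{k ∈ ℤ²} ( 1/(‖k‖² + m + μ) − 1/(‖k‖² + a) ) converges absolutely, so F_a(μ) := (1/2) ∑_{k ∈ ℤ²} ( 1/(‖k‖² + m + μ) − 1/(‖k‖² + a) ) is well defined; moreover there exists exactly one μ₀ ∈ (−m, ∞) satisfying F_a(μ₀) = μ₀. -/
open Set

lemma summable_one_div_int_sq_add_one : Summable fun n : ℤ => 1 / ((n : ℝ) ^ 2 + 1) := by
  have h := ((Real.summable_one_div_int_add_rpow (1 / 2) 2).mpr one_lt_two).mul_left 2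
  refine h.of_nonneg_of_le (fun n => by positivity) fun n => ?_
  have hn : (n : ℝ) + 1 / 2 ≠ 0 := by
    intro h0
    have h1 : ((2 * n + 1 : ℤ) : ℝ) = 0 := by push_cast; linarith
    have h2 : 2 * n + 1 = 0 := by exact_mod_cast h1
    omega
  have hpos : 0 < ((n : ℝ) + 1 / 2) ^ 2 := by positivity
  rw [Real.rpow_two, sq_abs, mul_one_div, div_le_div_iff₀ (by positivity) hpos]
  nlinarith [sq_nonneg ((n : ℝ) - 1)]

lemma summable_one_div_sq_add_sq_add_one_sq :
    Summable fun k : ℤ × ℤ => 1 / ((k.1 : ℝ) ^ 2 + (k.2 : ℝ) ^ 2 + 1) ^ 2 := by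
  have h := summable_one_div_int_sq_add_one.mul_of_nonneg summable_one_div_int_sq_add_one
    (fun n => by positivity) (fun n => by positivity)
  refine h.of_nonneg_of_le (fun k => by positivity) fun k => ?_
  rw [div_mul_div_comm, one_mul]
  apply one_div_le_one_div_of_le (by positivity)
  rw [sq (_ + 1)]
  apply mul_le_mul <;> nlinarith [sq_nonneg (k.1 : ℝ), sq_nonneg (k.2 : ℝ)]

lemma abs_one_div_add_sub_one_div_add_le {q s t : ℝ} (hq : 0 ≤ q) (hs : 0 < s) (ht : 0 < t) :
    |1 / (q + s) - 1 / (q + t)| ≤ |t - s| / (min s 1 * min t 1) * (1 / (q + 1) ^ 2) := by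
  have hs' : 0 < min s 1 := lt_min hs one_pos
  have ht' : 0 < min t 1 := lt_min ht one_pos
  have key : ∀ u : ℝ, 0 < u → min u 1 * (q + 1) ≤ q + u := fun u hu => by
    nlinarith [min_le_left u 1, mul_nonneg hq (sub_nonneg.mpr (min_le_right u 1))]
  have hqs : 0 < q + s := by positivity
  have hqt : 0 < q + t := by positivity
  rw [div_sub_div _ _ hqs.ne' hqt.ne', abs_div, abs_of_pos (mul_pos hqs hqt), div_mul_div_comm,
    mul_one, mul_one, one_mul, add_sub_add_left_eq_sub]
  apply div_le_div_of_nonneg_left (abs_nonneg _) (by positivity)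
  calc min s 1 * min t 1 * (q + 1) ^ 2 = (min s 1 * (q + 1)) * (min t 1 * (q + 1)) := by ring
    _ ≤ (q + s) * (q + t) := mul_le_mul (key s hs) (key t ht) (by positivity) hqs.le

section ResolventDifference

variable {ι : Type*} {q : ι → ℝ} {a : ℝ}

lemma summable_abs_one_div_add_sub (hq : ∀ k, 0 ≤ q k)
    (hsum : Summable fun k => 1 / (q k + 1) ^ 2) {x : ℝ} (hx : 0 < x) (ha : 0 < a) :
    Summable fun k => |1 / (q k + x) - 1 / (q k + a)| :=
  (hsum.mul_left _).of_nonneg_of_le (fun _ => abs_nonneg _)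
    fun k => abs_one_div_add_sub_one_div_add_le (hq k) hx ha

lemma antitoneOn_tsum_one_div_add_sub (hq : ∀ k, 0 ≤ q k)
    (hsum : Summable fun k => 1 / (q k + 1) ^ 2) (ha : 0 < a) :
    AntitoneOn (fun x => ∑' k, (1 / (q k + x) - 1 / (q k + a))) (Ioi 0) := by
  intro x hx y hy hxy
  have hx' : 0 < x := hx
  refine (summable_abs_one_div_add_sub hq hsum hy ha).of_abs.tsum_le_tsum (fun k => ?_)
    (summable_abs_one_div_add_sub hq hsum hx ha).of_abs
  have := hq k
  gcongr

lemma continuousOn_tsum_one_div_add_sub (hq : ∀ k, 0 ≤ q k)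
    (hsum : Summable fun k => 1 / (q k + 1) ^ 2) (ha : 0 < a) {r R : ℝ} (hr : 0 < r) :
    ContinuousOn (fun x => ∑' k, (1 / (q k + x) - 1 / (q k + a))) (Icc r R) := by
  refine continuousOn_tsum (fun k => ?_)
    (hsum.mul_left ((a + R) / (min r 1 * min a 1))) fun k x hx => ?_
  · refine (continuousOn_const.div (by fun_prop) fun x hx => ?_).sub continuousOn_const
    have := hq k
    have : 0 < x := hr.trans_le hx.1
    positivity
  · have hx0 : 0 < x := hr.trans_le hx.1
    have hr' : 0 < min r 1 := lt_min hr one_pos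
    have ha' : 0 < min a 1 := lt_min ha one_pos
    have hR : 0 < R := hx0.trans_le hx.2
    refine (abs_one_div_add_sub_one_div_add_le (hq k) hx0 ha).trans ?_
    have h1 : |a - x| ≤ a + R := abs_le.mpr ⟨by linarith [hx.2], by linarith⟩
    have h2 : min r 1 ≤ min x 1 := min_le_min_right 1 hx.1
    gcongr

lemma exists_half_tsum_one_div_add_sub_eq (hq : ∀ k, 0 ≤ q k)
    (hsum : Summable fun k => 1 / (q k + 1) ^ 2) (ha : 0 < a) {m : ℝ} (hm : 0 ≤ m)
    {i : ι} (hi : q i = 0) :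
    ∃ x, 0 < x ∧ (1 / 2) * ∑' k, (1 / (q k + x) - 1 / (q k + a)) = x - m := by
  set G : ℝ → ℝ := fun x => ∑' k, (1 / (q k + x) - 1 / (q k + a))
  set r : ℝ := a / (1 + 2 * a ^ 2) with hrdef
  have hr : 0 < r := by positivity
  have hra : r ≤ a := div_le_self ha.le (by nlinarith [sq_nonneg a])
  have hGr : 2 * a ≤ G r := by
    have hle : 1 / (q i + r) - 1 / (q i + a) ≤ G r :=
      (summable_abs_one_div_add_sub hq hsum hr ha).of_abs.le_tsum i fun k _ => by
        have := hq k
        have : 1 / (q k + a) ≤ 1 / (q k + r) := by gcongr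
        linarith
    have heq : 1 / (q i + r) - 1 / (q i + a) = 2 * a := by
      rw [hi, hrdef]
      field_simp
      ring
    linarith
  have hGa : G (a + m) ≤ 0 := tsum_nonpos fun k => by
    have := hq k
    have : 1 / (q k + (a + m)) ≤ 1 / (q k + a) := by gcongr; linarith
    linarith
  have hcont : ContinuousOn (fun x => (1 / 2) * G x - (x - m)) (Icc r (a + m)) :=
    (continuousOn_const.mul (continuousOn_tsum_one_div_add_sub hq hsum ha hr)).sub (by fun_prop)
  obtain ⟨x, hx, hx0⟩ := intermediate_value_Icc' (by linarith) hcont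
    (show (0 : ℝ) ∈ Icc _ _ from ⟨by linarith, by linarith⟩)
  exact ⟨x, hr.trans_le hx.1, sub_eq_zero.mp hx0⟩

end ResolventDifference

/-- For `m ≥ 0`, `a > 0` and `μ > -m`, the series
`∑_{k ∈ ℤ²} (1/(‖k‖²+m+μ) − 1/(‖k‖²+a))` converges absolutely, and there exists exactly
one `μ₀ ∈ (−m, ∞)` solving the self-consistent equation
`(1/2) ∑_{k ∈ ℤ²} (1/(‖k‖²+m+μ₀) − 1/(‖k‖²+a)) = μ₀`. -/
theorem stmt_5 (m a : ℝ) (hm : 0 ≤ m) (ha : 0 < a) :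
    (∀ μ : ℝ, -m < μ →
      Summable (fun k : ℤ × ℤ =>
        |1 / ((k.1 : ℝ) ^ 2 + (k.2 : ℝ) ^ 2 + m + μ)
          - 1 / ((k.1 : ℝ) ^ 2 + (k.2 : ℝ) ^ 2 + a)|)) ∧
    (∃! μ₀ : ℝ, -m < μ₀ ∧
      (1 / 2) * ∑' k : ℤ × ℤ,
          (1 / ((k.1 : ℝ) ^ 2 + (k.2 : ℝ) ^ 2 + m + μ₀)
            - 1 / ((k.1 : ℝ) ^ 2 + (k.2 : ℝ) ^ 2 + a)) = μ₀) := by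
  have hq : ∀ k : ℤ × ℤ, (0 : ℝ) ≤ (k.1 : ℝ) ^ 2 + (k.2 : ℝ) ^ 2 := fun k => by positivity
  have hsum := summable_one_div_sq_add_sq_add_one_sq
  simp only [add_assoc _ m]
  refine ⟨fun μ hμ => summable_abs_one_div_add_sub hq hsum (by linarith) ha, ?_⟩
  obtain ⟨x, hx, hxm⟩ :=
    exists_half_tsum_one_div_add_sub_eq hq hsum ha hm (i := (0, 0)) (by simp)
  have hanti := antitoneOn_tsum_one_div_add_sub hq hsum ha
  refine ⟨x - m, ⟨by linarith, by rwa [add_sub_cancel]⟩, fun μ ⟨hμ, hμm⟩ => ?_⟩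
  have hμ0 : 0 < m + μ := by linarith
  rcases le_total x (m + μ) with h | h
  · have := hanti hx hμ0 h
    dsimp only at this
    linarith
  · have := hanti hμ0 hx h
    dsimp only at this
    linarith
end

section
/- Let C ≥ 1 and N ≥ 1 be real numbers, and let (A_q)_{q ≥ 1} be a sequence of nonnegative real numbers indexed by the positive integers satisfying: (i) A_q ≤ C N^{(q−1)/2} for every integer q ≥ 1, and (ii) A_q ≤ C ( A_{q+1}^{q/(q+1)} N^{−1/2} + 1 ) for every integer q ≥ 1. Then for every integer q ≥ 1 there exists a constant C_q, depending only on q and C (and not on N or on the sequence (A_q)), such that A_q ≤ C_q. -/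
/-- One bootstrap step: a bound of order `N ^ ((q + 1) (s + 1 / (2 q)))` on the moment of order
`q + 1` gives a bound of order `N ^ (q s)` on the moment of order `q`. -/
lemma bootstrap_step {C D N s a b : ℝ} {q : ℕ} (hC : 0 ≤ C) (hD : 0 ≤ D) (hN : 1 ≤ N)
    (hs : 0 ≤ s) (hq : 1 ≤ q) (hb : 0 ≤ b)
    (hbD : b ≤ D * N ^ (((q : ℝ) + 1) * (s + 1 / (2 * (q : ℝ)))))
    (hab : a ≤ C * (b ^ ((q : ℝ) / ((q : ℝ) + 1)) * N ^ (-(1 : ℝ) / 2) + 1)) :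
    a ≤ C * (D ^ ((q : ℝ) / ((q : ℝ) + 1)) + 1) * N ^ ((q : ℝ) * s) := by
  have hN0 : 0 < N := by linarith
  have hq0 : (0 : ℝ) < q := by exact_mod_cast hq
  set θ : ℝ := (q : ℝ) / ((q : ℝ) + 1) with hθ
  have hθ0 : 0 ≤ θ := by positivity
  have hpow : b ^ θ * N ^ (-(1 : ℝ) / 2) ≤ D ^ θ * N ^ ((q : ℝ) * s) :=
    calc b ^ θ * N ^ (-(1 : ℝ) / 2)
        ≤ (D * N ^ (((q : ℝ) + 1) * (s + 1 / (2 * (q : ℝ))))) ^ θ * N ^ (-(1 : ℝ) / 2) := by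
          gcongr
      _ = D ^ θ * N ^ ((q : ℝ) * s) := by
          rw [Real.mul_rpow hD (by positivity), ← Real.rpow_mul hN0.le, mul_assoc,
            ← Real.rpow_add hN0]
          congr 2
          rw [hθ]
          field_simp
          ring
  have hone : 1 ≤ N ^ ((q : ℝ) * s) := Real.one_le_rpow hN (by positivity)
  calc a ≤ C * (b ^ θ * N ^ (-(1 : ℝ) / 2) + 1) := hab
    _ ≤ C * (D ^ θ * N ^ ((q : ℝ) * s) + N ^ ((q : ℝ) * s)) := by gcongr
    _ = C * (D ^ θ + 1) * N ^ ((q : ℝ) * s) := by ring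

/-- After `n` bootstrap steps the moment of order `q` is of order `N ^ (q s)` for every
`s ≥ 0` with `1 / 2 ≤ s + ∑ k < n, 1 / (2 (q + k))`. -/
lemma bootstrap_iterate {C : ℝ} (hC : 1 ≤ C) (n : ℕ) :
    ∀ (q : ℕ) (s : ℝ), 1 ≤ q → 0 ≤ s →
      1 / 2 ≤ s + ∑ k ∈ Finset.range n, 1 / (2 * ((q + k : ℕ) : ℝ)) →
      ∃ D : ℝ, 0 ≤ D ∧ ∀ (N : ℝ), 1 ≤ N → ∀ A : ℕ → ℝ,
        (∀ q' : ℕ, 1 ≤ q' → 0 ≤ A q') →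
        (∀ q' : ℕ, 1 ≤ q' → A q' ≤ C * N ^ (((q' : ℝ) - 1) / 2)) →
        (∀ q' : ℕ, 1 ≤ q' →
          A q' ≤ C * (A (q' + 1) ^ ((q' : ℝ) / ((q' : ℝ) + 1)) * N ^ (-(1 : ℝ) / 2) + 1)) →
        A q ≤ D * N ^ ((q : ℝ) * s) := by
  induction n with
  | zero =>
    intro q s hq hs h
    refine ⟨C, by linarith, fun N hN A _ hA _ => (hA q hq).trans ?_⟩
    have hq0 : (0 : ℝ) ≤ q := q.cast_nonneg
    simp only [Finset.range_zero, Finset.sum_empty, add_zero] at h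
    gcongr
    nlinarith
  | succ n ih =>
    intro q s hq hs h
    obtain ⟨D, hD, hbound⟩ := ih (q + 1) (s + 1 / (2 * (q : ℝ))) (by omega) (by positivity) (by
      rw [Finset.sum_range_succ'] at h
      simp only [add_zero, add_assoc, add_comm 1] at h ⊢
      linarith)
    refine ⟨C * (D ^ ((q : ℝ) / ((q : ℝ) + 1)) + 1), by positivity, fun N hN A h0 h1 h2 => ?_⟩
    refine bootstrap_step (by linarith) hD hN hs hq (h0 (q + 1) (by omega)) ?_ (h2 q hq)
    simpa using hbound N hN A h0 h1 h2

lemma exists_le_sum_range_one_div_add (q : ℕ) (x : ℝ) :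
    ∃ n : ℕ, x ≤ ∑ k ∈ Finset.range n, 1 / ((q + k : ℕ) : ℝ) := by
  have hns : ¬ Summable fun k : ℕ => 1 / ((q + k : ℕ) : ℝ) := by
    simp only [add_comm q]
    rw [summable_nat_add_iff (f := fun k : ℕ => 1 / (k : ℝ))]
    exact Real.not_summable_one_div_natCast
  rw [not_summable_iff_tendsto_nat_atTop_of_nonneg (fun k => by positivity)] at hns
  exact (hns.eventually_ge_atTop x).exists

/-- Bootstrap iteration: if `A_q ≤ C N^{(q-1)/2}` and
`A_q ≤ C (A_{q+1}^{q/(q+1)} N^{-1/2} + 1)` for all integers `q ≥ 1`, then each `A_q` is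
bounded by a constant depending only on `q` and `C` (not on `N` or the sequence). -/
theorem stmt_8 (C : ℝ) (hC : 1 ≤ C) (q : ℕ) (hq : 1 ≤ q) :
    ∃ Cq : ℝ, ∀ (N : ℝ), 1 ≤ N → ∀ A : ℕ → ℝ,
      (∀ q' : ℕ, 1 ≤ q' → 0 ≤ A q') →
      (∀ q' : ℕ, 1 ≤ q' → A q' ≤ C * N ^ (((q' : ℝ) - 1) / 2)) →
      (∀ q' : ℕ, 1 ≤ q' →
        A q' ≤ C * (A (q' + 1) ^ ((q' : ℝ) / ((q' : ℝ) + 1)) * N ^ (-(1 : ℝ) / 2) + 1)) →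
      A q ≤ Cq := by
  obtain ⟨n, hn⟩ := exists_le_sum_range_one_div_add q 1
  have hsum : (1 : ℝ) / 2 ≤ 0 + ∑ k ∈ Finset.range n, 1 / (2 * ((q + k : ℕ) : ℝ)) := by
    simp only [← div_div, div_right_comm (1 : ℝ) 2, ← Finset.sum_div]
    linarith
  obtain ⟨D, -, hD⟩ := bootstrap_iterate hC n q 0 hq le_rfl hsum
  exact ⟨D, fun N hN A h0 h1 h2 => by simpa using hD N hN A h0 h1 h2⟩
end

section
/- Let T > 0 and let q ≥ 1 be a real number. Let V : [0, T] → [0, ∞) be differentiable and let G, R : [0, T] → [0, ∞) be continuous, and assume that for every t ∈ [0, T]: V(t)² ≤ G(t) and V'(t) + G(t) ≤ R(t). Then for every t ∈ [0, T], V(t)^q + (2q/(q+1)) ∫₀ᵗ V(s)^{q−1} G(s) ds ≤ V(0)^q + (2q/(q+1)) ∫₀ᵗ R(s)^{(q+1)/2} ds. -/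
/-- Young's inequality with exponents `(q + 1) / 2` and `(q + 1) / (q - 1)`, including the
degenerate case `q = 1`. -/
theorem rpow_sub_one_mul_le_young {q v r : ℝ} (hq : 1 ≤ q) (hv : 0 ≤ v) (hr : 0 ≤ r) :
    v ^ (q - 1) * r ≤
      2 / (q + 1) * r ^ ((q + 1) / 2) + (q - 1) / (q + 1) * v ^ (q + 1) := by
  have hq1 : 0 < q + 1 := by linarith
  have young := Real.geom_mean_le_arith_mean2_weighted
    (w₁ := 2 / (q + 1)) (w₂ := (q - 1) / (q + 1)) (p₁ := r ^ ((q + 1) / 2)) (p₂ := v ^ (q + 1))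
    (by positivity) (div_nonneg (by linarith) hq1.le) (by positivity) (by positivity)
    (by field_simp; ring)
  rw [← Real.rpow_mul hr, ← Real.rpow_mul hv,
    show (q + 1) / 2 * (2 / (q + 1)) = 1 by field_simp,
    show (q + 1) * ((q - 1) / (q + 1)) = q - 1 by field_simp, Real.rpow_one] at young
  linarith

/-- If `v² ≤ g` and `w + g ≤ r`, then `q v^(q-1) w` is bounded by the difference of the
forcing and dissipation terms. -/
theorem mul_rpow_sub_one_mul_le {q v w g r : ℝ} (hq : 1 ≤ q) (hv : 0 ≤ v) (hr : 0 ≤ r)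
    (hdom : v ^ 2 ≤ g) (hineq : w + g ≤ r) :
    w * q * v ^ (q - 1) ≤
      2 * q / (q + 1) * r ^ ((q + 1) / 2) - 2 * q / (q + 1) * (v ^ (q - 1) * g) := by
  have hq1 : 0 < q + 1 := by linarith
  have hsplit : v ^ (q + 1) = v ^ (q - 1) * v ^ 2 := by
    rw [← Real.rpow_natCast v 2, ← Real.rpow_add_of_nonneg hv (by linarith) (by norm_num)]
    congr 1
    push_cast
    ring
  have hpow : 0 ≤ v ^ (q - 1) := Real.rpow_nonneg hv _
  have hdiss : (q - 1) / (q + 1) * v ^ (q + 1) ≤ (q - 1) / (q + 1) * (v ^ (q - 1) * g) := by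
    rw [hsplit]
    have : 0 ≤ (q - 1) / (q + 1) := div_nonneg (by linarith) hq1.le
    gcongr
  have hw : v ^ (q - 1) * w ≤ v ^ (q - 1) * (r - g) :=
    mul_le_mul_of_nonneg_left (by linarith) hpow
  have hcoef : (q - 1) / (q + 1) = 1 - 2 / (q + 1) := by field_simp; ring
  have hmain : v ^ (q - 1) * w ≤
      2 / (q + 1) * r ^ ((q + 1) / 2) - 2 / (q + 1) * (v ^ (q - 1) * g) := by
    have young := rpow_sub_one_mul_le_young hq hv hr
    rw [hcoef] at young hdiss
    linarith
  calc w * q * v ^ (q - 1) = q * (v ^ (q - 1) * w) := by ring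
    _ ≤ q * (2 / (q + 1) * r ^ ((q + 1) / 2) - 2 / (q + 1) * (v ^ (q - 1) * g)) :=
        mul_le_mul_of_nonneg_left hmain (by linarith)
    _ = _ := by ring

/-- Differential-inequality mechanism: if `V² ≤ G` and `V' + G ≤ R` on `[0,T]`, then for
every `t ∈ [0,T]`,
`V(t)^q + (2q/(q+1)) ∫₀ᵗ V^{q-1} G ≤ V(0)^q + (2q/(q+1)) ∫₀ᵗ R^{(q+1)/2}`. -/
theorem stmt_9 (T q : ℝ) (hT : 0 < T) (hq : 1 ≤ q)
    (V V' G R : ℝ → ℝ)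
    (hVnonneg : ∀ t ∈ Set.Icc (0 : ℝ) T, 0 ≤ V t)
    (hGnonneg : ∀ t ∈ Set.Icc (0 : ℝ) T, 0 ≤ G t)
    (hRnonneg : ∀ t ∈ Set.Icc (0 : ℝ) T, 0 ≤ R t)
    (hVderiv : ∀ t ∈ Set.Icc (0 : ℝ) T, HasDerivWithinAt V (V' t) (Set.Icc (0 : ℝ) T) t)
    (hGcont : ContinuousOn G (Set.Icc (0 : ℝ) T))
    (hRcont : ContinuousOn R (Set.Icc (0 : ℝ) T))
    (hdom : ∀ t ∈ Set.Icc (0 : ℝ) T, (V t) ^ 2 ≤ G t)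
    (hineq : ∀ t ∈ Set.Icc (0 : ℝ) T, V' t + G t ≤ R t) :
    ∀ t ∈ Set.Icc (0 : ℝ) T,
      V t ^ q + (2 * q / (q + 1)) * ∫ s in (0 : ℝ)..t, V s ^ (q - 1) * G s
        ≤ V 0 ^ q + (2 * q / (q + 1)) * ∫ s in (0 : ℝ)..t, R s ^ ((q + 1) / 2) := by
  intro t ht
  have hsub : Set.Icc 0 t ⊆ Set.Icc 0 T := Set.Icc_subset_Icc_right ht.2
  have hV : ContinuousOn V (Set.Icc 0 t) :=
    fun s hs => (hVderiv s (hsub hs)).continuousWithinAt.mono hsub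
  have hdiss : ContinuousOn (fun s => V s ^ (q - 1) * G s) (Set.Icc 0 t) :=
    (hV.rpow_const fun _ _ => Or.inr (by linarith)).mul (hGcont.mono hsub)
  have hforce : ContinuousOn (fun s => R s ^ ((q + 1) / 2)) (Set.Icc 0 t) :=
    (hRcont.mono hsub).rpow_const fun _ _ => Or.inr (by linarith)
  have hle := intervalIntegral.sub_le_integral_of_hasDeriv_right_of_le
    (g := fun s => V s ^ q) (g' := fun s => V' s * q * V s ^ (q - 1))
    (φ := fun s => 2 * q / (q + 1) * R s ^ ((q + 1) / 2)
      - 2 * q / (q + 1) * (V s ^ (q - 1) * G s))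
    ht.1 (hV.rpow_const fun _ _ => Or.inr (by linarith))
    (fun s hs => by
      have hd : HasDerivAt V (V' s) s := (hVderiv s (hsub (Set.Ioo_subset_Icc_self hs))).hasDerivAt
        (Icc_mem_nhds hs.1 (hs.2.trans_le ht.2))
      exact (hd.rpow_const (Or.inr hq)).hasDerivWithinAt)
    ((hforce.const_mul _).sub (hdiss.const_mul _)).integrableOn_Icc
    (fun s hs => by
      have hs' := hsub (Set.Ioo_subset_Icc_self hs)
      exact mul_rpow_sub_one_mul_le hq (hVnonneg s hs') (hRnonneg s hs') (hdom s hs') (hineq s hs'))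
  rw [intervalIntegral.integral_sub
      ((hforce.intervalIntegrable_of_Icc ht.1).const_mul _)
      ((hdiss.intervalIntegrable_of_Icc ht.1).const_mul _),
    intervalIntegral.integral_const_mul, intervalIntegral.integral_const_mul] at hle
  linarith
end

section
/- Let c₁, c₂, c₃ > 0 and let m ≥ 2c₃. Let f : (0, ∞) → [0, ∞) be differentiable and assume that for every t > 0 both f'(t) + c₁ f(t)² ≤ c₂ and f'(t) + m f(t) ≤ c₃ f(t). Then sup_{t ≥ 1} e^{m t / 2} f(t) ≤ e^{m/2} · max( 2/c₁, (2c₂/c₁)^{1/2} ). -/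
/-- A function dominated by `f' ≤ -a f²` on `(0, T]` while positive there comes down from infinity:
`a T f(T) ≤ 1`. -/
theorem mul_le_one_of_hasDerivAt_le_neg_mul_sq {a T : ℝ} (ha : 0 < a) (hT : 0 < T)
    {f f' : ℝ → ℝ} (hpos : ∀ t ∈ Set.Ioc 0 T, 0 < f t)
    (hderiv : ∀ t ∈ Set.Ioc 0 T, HasDerivAt f (f' t) t)
    (hle : ∀ t ∈ Set.Ioc 0 T, f' t ≤ -(a * f t ^ 2)) : a * T * f T ≤ 1 := by
  have hTmem : T ∈ Set.Ioc 0 T := ⟨hT, le_rfl⟩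
  have hfT := hpos T hTmem
  by_contra! hlt
  have hd : ∀ t ∈ Set.Ioc 0 T,
      HasDerivAt (fun s => a * s - (f s)⁻¹) (a * 1 - -f' t / f t ^ 2) t := fun t ht =>
    ((hasDerivAt_id t).const_mul a).sub ((hderiv t ht).inv (hpos t ht).ne')
  have hanti : AntitoneOn (fun s => a * s - (f s)⁻¹) (Set.Ioc 0 T) := by
    refine antitoneOn_of_hasDerivWithinAt_nonpos (convex_Ioc 0 T)
      (fun t ht => (hd t ht).continuousAt.continuousWithinAt)
      (fun t ht => (hd t (interior_subset ht)).hasDerivWithinAt) fun t ht => ?_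
    have ht' := interior_subset ht
    have hsq : 0 < f t ^ 2 := pow_pos (hpos t ht') 2
    have : a ≤ -f' t / f t ^ 2 := by
      rw [le_div_iff₀ hsq]
      linarith [hle t ht']
    linarith
  have hs : T - (f T)⁻¹ / a ∈ Set.Ioc 0 T := by
    constructor
    · rw [sub_pos, div_lt_iff₀ ha, inv_lt_iff_one_lt_mul₀ hfT]
      linarith
    · have : 0 < (f T)⁻¹ / a := by positivity
      linarith
  have h := hanti hs hTmem hs.2
  have hinv := inv_pos.mpr (hpos _ hs)
  have hmul : a * (T - (f T)⁻¹ / a) = a * T - (f T)⁻¹ := by field_simp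
  simp only [hmul] at h
  linarith

/-- If `f ≥ 0` satisfies both `f' + c₁ f² ≤ c₂` and `f' + m f ≤ c₃ f` on `(0,∞)` with
`m ≥ 2c₃`, then `e^{mt/2} f(t) ≤ e^{m/2} max(2/c₁, (2c₂/c₁)^{1/2})` for all `t ≥ 1`. -/
theorem stmt_11 (c₁ c₂ c₃ m : ℝ) (hc₁ : 0 < c₁) (hc₂ : 0 < c₂) (hc₃ : 0 < c₃)
    (hm : 2 * c₃ ≤ m)
    (f f' : ℝ → ℝ)
    (hnonneg : ∀ t : ℝ, 0 < t → 0 ≤ f t)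
    (hderiv : ∀ t : ℝ, 0 < t → HasDerivAt f (f' t) t)
    (hquad : ∀ t : ℝ, 0 < t → f' t + c₁ * (f t) ^ 2 ≤ c₂)
    (hlin : ∀ t : ℝ, 0 < t → f' t + m * f t ≤ c₃ * f t) :
    ∀ t : ℝ, 1 ≤ t →
      Real.exp (m * t / 2) * f t
        ≤ Real.exp (m / 2) * max (2 / c₁) (Real.sqrt (2 * c₂ / c₁)) := by
  have hexp : AntitoneOn (fun t => Real.exp (m * t / 2) * f t) (Set.Ioi 0) := by
    have hd : ∀ t ∈ Set.Ioi (0 : ℝ), HasDerivAt (fun t => Real.exp (m * t / 2) * f t)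
        (Real.exp (m * t / 2) * (m * 1 / 2) * f t + Real.exp (m * t / 2) * f' t) t :=
      fun t ht => (((hasDerivAt_id t).const_mul m).div_const 2).exp.mul (hderiv t ht)
    refine antitoneOn_of_hasDerivWithinAt_nonpos (convex_Ioi 0)
      (fun t ht => (hd t ht).continuousAt.continuousWithinAt)
      (fun t ht => (hd t (interior_subset ht)).hasDerivWithinAt) fun t ht => ?_
    have ht' : 0 < t := interior_subset ht
    have : m / 2 * f t + f' t ≤ 0 := by
      nlinarith [hlin t ht', hnonneg t ht']
    nlinarith [Real.exp_pos (m * t / 2)]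
  have hanti : AntitoneOn f (Set.Ioi 0) := by
    refine antitoneOn_of_hasDerivWithinAt_nonpos (convex_Ioi 0)
      (fun t ht => (hderiv t ht).continuousAt.continuousWithinAt)
      (fun t ht => (hderiv t (interior_subset ht)).hasDerivWithinAt) fun t ht => ?_
    have ht' : 0 < t := interior_subset ht
    nlinarith [hlin t ht', hnonneg t ht']
  have hone : f 1 ≤ max (2 / c₁) (Real.sqrt (2 * c₂ / c₁)) := by
    by_contra! hlt
    obtain ⟨hlt₁, hlt₂⟩ := max_lt_iff.mp hlt
    have hf1 : 0 < f 1 := (by positivity : 0 < 2 / c₁).trans hlt₁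
    have hge : ∀ t ∈ Set.Ioc (0 : ℝ) 1, f 1 ≤ f t := fun t ht =>
      hanti ht.1 (Set.mem_Ioi.mpr one_pos) ht.2
    have hsq : 2 * c₂ < f 1 ^ 2 * c₁ := by
      rwa [Real.sqrt_lt' hf1, div_lt_iff₀ hc₁] at hlt₂
    have h := mul_le_one_of_hasDerivAt_le_neg_mul_sq (half_pos hc₁) one_pos
      (fun t ht => hf1.trans_le (hge t ht)) (fun t ht => hderiv t ht.1) fun t ht => by
        have : f 1 ^ 2 * c₁ ≤ f t ^ 2 * c₁ := by
          gcongr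
          exact hge t ht
        linarith [hquad t ht.1]
    rw [div_lt_iff₀ hc₁] at hlt₁
    linarith
  intro t ht
  calc Real.exp (m * t / 2) * f t ≤ Real.exp (m * 1 / 2) * f 1 :=
        hexp (Set.mem_Ioi.mpr one_pos) (Set.mem_Ioi.mpr (one_pos.trans_le ht)) ht
    _ ≤ Real.exp (m / 2) * max (2 / c₁) (Real.sqrt (2 * c₂ / c₁)) := by
        rw [mul_one]
        gcongr
end
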